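/- arXiv:2508.01792 — 2 statements merged into one kernel-verified Lean document; each statement's English description precedes it below -/
import Mathlib

section
/- Let X be a pure simplicial complex of rank n ≥ 2. If X is an n-PCM or an n-surface, then X is a normal pseudomanifold of rank n, i.e. X is a pseudomanifold and for every simplex h ∈ X with dim(h) ≤ n − 2 the link lk(h, X) is a pseudomanifold. -/
namespace PCMPaper

variable {α : Type*} [PartialOrder α]

/-- The set of elements of `X` strictly below `h` (α□_X(h)). -/
def alphaS (X : Set α) (h : α) : Set α := {x ∈ X | x < h}

/-- The set of elements of `X` strictly above `h` (β□_X(h)). -/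
def betaS (X : Set α) (h : α) : Set α := {x ∈ X | h < x}

/-- The (strict) neighborhood θ□_X(h) = α□_X(h) ∪ β□_X(h). -/
def thetaS (X : Set α) (h : α) : Set α := alphaS X h ∪ betaS X h

/-- The rank of `h` in the poset `X`: the maximal length of a strictly increasing
chain in `X` ending at `h`.  (It equals 0 when α□_X(h) = ∅ and
`max_{x ∈ α□_X(h)} rank X x + 1` otherwise, for finite `X`.) -/
noncomputable def rank (X : Set α) (h : α) : ℕ :=
  sSup {n : ℕ | ∃ c : Fin (n + 1) → α, StrictMono c ∧ (∀ i, c i ∈ X) ∧ c (Fin.last n) = h}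

open scoped Classical in
/-- The rank of the poset `X`: maximal rank of its elements, `-1` if empty. -/
noncomputable def rankSet (X : Set α) : ℤ :=
  if X = ∅ then -1 else ((sSup (rank X '' X) : ℕ) : ℤ)

/-- One step of a path in `X`: two distinct comparable elements of `X`. -/
def rel (X : Set α) (x y : α) : Prop :=
  x ∈ X ∧ y ∈ X ∧ x ≠ y ∧ (x < y ∨ y < x)

/-- `X` is (path-)connected: any two elements are joined by a path in `X`. -/
def IsConnected (X : Set α) : Prop :=
  ∀ x ∈ X, ∀ y ∈ X, Relation.ReflTransGen (rel X) x y

/-- `IsSurfaceAux (k + 1) X` means that `X` is a (discrete) `k`-surface. -/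
def IsSurfaceAux : ℕ → Set α → Prop
  | 0, X => X = ∅
  | 1, X => ∃ x y : α, x ≠ y ∧ ¬ x < y ∧ ¬ y < x ∧ X = {x, y}
  | (n + 2), X => X.Nonempty ∧ IsConnected X ∧ ∀ h ∈ X, IsSurfaceAux (n + 1) (thetaS X h)

/-- `X` is a discrete `k`-surface (`k : ℤ`, `k ≥ -1`). -/
def IsSurface (k : ℤ) (X : Set α) : Prop :=
  ∃ n : ℕ, (n : ℤ) = k + 1 ∧ IsSurfaceAux n X

/-- The border ΔX of a poset `X` of rank `n`:
elements whose neighborhood is not an `(n-1)`-surface. -/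
def border (X : Set α) : Set α :=
  {h ∈ X | ¬ IsSurface (rankSet X - 1) (thetaS X h)}

/-- The interior of `X`. -/
def interior' (X : Set α) : Set α := X \ border X

/-- `IsPCMAux (n + 1) X` means that `X` is an `n`-PCM. -/
def IsPCMAux : ℕ → Set α → Prop
  | 0, X => X = ∅
  | 1, X => ∃ x : α, X = {x}
  | (n + 2), X => rankSet X = ((n : ℤ) + 1) ∧ IsConnected X ∧ border X ≠ ∅ ∧
      ∀ h ∈ X, (h ∈ border X → IsPCMAux (n + 1) (thetaS X h)) ∧
               (h ∉ border X → IsSurfaceAux (n + 1) (thetaS X h))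

/-- `X` is an `k`-PCM (`k : ℤ`, `k ≥ -1`). -/
def IsPCM (k : ℤ) (X : Set α) : Prop :=
  ∃ n : ℕ, (n : ℤ) = k + 1 ∧ IsPCMAux n X

/-- Fuel-indexed coherence. -/
def IsCoherentAux : ℕ → Set α → Prop
  | 0, X => X = ∅
  | (n + 1), X => X = ∅ ∨
      ∀ h ∈ X, rankSet (thetaS X h) = rankSet X - 1 ∧ IsCoherentAux n (thetaS X h)

/-- `X` is a coherent poset. -/
def IsCoherent (X : Set α) : Prop := ∃ n : ℕ, IsCoherentAux n X

/-- `X` is a separated union of `(m-1)`-surfaces: a union of `(m-1)`-surfaces such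
that no element of one of them is comparable to an element of another one. -/
def IsSeparatedUnionOfSurfacesAux (m : ℕ) (X : Set α) : Prop :=
  ∃ P : Set (Set α), P.Nonempty ∧ X = ⋃₀ P ∧ (∀ S ∈ P, IsSurfaceAux m S) ∧
    ∀ S ∈ P, ∀ T ∈ P, S ≠ T → ∀ x ∈ S, ∀ y ∈ T, ¬ x ≤ y ∧ ¬ y ≤ x

/-- `IsSmoothPCMAux (n + 1) X` means that `X` is a smooth `n`-PCM. -/
def IsSmoothPCMAux : ℕ → Set α → Prop
  | 0, X => X = ∅
  | 1, X => ∃ x : α, X = {x}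
  | (n + 2), X => rankSet X = ((n : ℤ) + 1) ∧ IsConnected X ∧ border X ≠ ∅ ∧
      IsSeparatedUnionOfSurfacesAux (n + 1) (border X) ∧
      ∀ h ∈ X, IsSurfaceAux (n + 1) (thetaS X h) ∨ IsSmoothPCMAux (n + 1) (thetaS X h)

/-- `X` is a smooth `k`-PCM (`k : ℤ`, `k ≥ -1`). -/
def IsSmoothPCM (k : ℤ) (X : Set α) : Prop :=
  ∃ n : ℕ, (n : ℤ) = k + 1 ∧ IsSmoothPCMAux n X

/-- A simplicial complex: a finite family of nonempty finite sets, closed under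
taking nonempty subsets and under nonempty intersections. -/
def IsSimplicialComplex {V : Type*} [DecidableEq V] (X : Set (Finset V)) : Prop :=
  X.Finite ∧ (∀ h ∈ X, h.Nonempty) ∧
  (∀ h ∈ X, ∀ h' : Finset V, h'.Nonempty → h' ⊆ h → h' ∈ X) ∧
  (∀ h ∈ X, ∀ h' ∈ X, (h ∩ h').Nonempty → h ∩ h' ∈ X)

/-- The dimension of a simplex. -/
def dim {V : Type*} (h : Finset V) : ℤ := (h.card : ℤ) - 1

/-- The link of a simplex `h` in a family of simplices `S`. -/
def link {V : Type*} [DecidableEq V] (h : Finset V) (S : Set (Finset V)) : Set (Finset V) :=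
  {h' ∈ S | h ∩ h' = ∅ ∧ h ∪ h' ∈ S}

/-- `X` is pure of rank `n`: every simplex is contained in an `n`-dimensional one. -/
def Pure {V : Type*} (X : Set (Finset V)) (n : ℤ) : Prop :=
  ∀ h ∈ X, ∃ g ∈ X, h ⊆ g ∧ dim g = n

/-- Any two `n`-simplices of `X` are joined by a path in `X` all of whose elements
are simplices of dimension `n - 1` or `n` (i.e. `X` is `(n-1)`-connected). -/
def NConnected {V : Type*} (X : Set (Finset V)) (n : ℤ) : Prop :=
  ∀ a ∈ X, dim a = n → ∀ b ∈ X, dim b = n →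
    Relation.ReflTransGen (rel {h | h ∈ X ∧ (dim h = n - 1 ∨ dim h = n)}) a b

/-- `X` is a pseudomanifold of rank `n`. -/
def IsPseudomanifold {V : Type*} [DecidableEq V] (X : Set (Finset V)) (n : ℤ) : Prop :=
  IsSimplicialComplex X ∧ rankSet X = n ∧
  ((n = 0 ∧ ∃ v : V, X = {({v} : Finset V)}) ∨
   (1 ≤ n ∧ Pure X n ∧
    (∀ h ∈ X, dim h = n - 1 →
      Set.ncard {g | g ∈ X ∧ h ⊆ g ∧ dim g = n} ∈ ({1, 2} : Set ℕ)) ∧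
    NConnected X n))

/-- `X` is a normal pseudomanifold of rank `n`: a pseudomanifold such that the link
of every simplex of dimension at most `n - 2` is a pseudomanifold. -/
def IsNormalPseudomanifold {V : Type*} [DecidableEq V] (X : Set (Finset V)) (n : ℤ) : Prop :=
  IsPseudomanifold X n ∧
  ∀ h ∈ X, dim h ≤ n - 2 → IsPseudomanifold (link h X) (n - dim h - 1)


/-- `IsManifoldAux (k + 1) X` means that `X` is a `k`-PCM or a `k`-surface. -/
def IsManifoldAux (k : ℕ) (X : Set α) : Prop := IsPCMAux k X ∨ IsSurfaceAux k X

theorem IsManifoldAux.thetaS {k : ℕ} {X : Set α} (hX : IsManifoldAux (k + 2) X) {h : α}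
    (hh : h ∈ X) : IsManifoldAux (k + 1) (thetaS X h) := by
  rcases hX with ⟨-, -, -, hX⟩ | ⟨-, -, hX⟩
  · by_cases hb : h ∈ border X
    · exact Or.inl ((hX h hh).1 hb)
    · exact Or.inr ((hX h hh).2 hb)
  · exact Or.inr (hX h hh)

theorem IsManifoldAux.isConnected {k : ℕ} {X : Set α} (hX : IsManifoldAux (k + 2) X) :
    IsConnected X := by
  rcases hX with ⟨-, hX, -⟩ | ⟨-, hX, -⟩ <;> exact hX

theorem IsManifoldAux.ncard_of_one {X : Set α} (hX : IsManifoldAux 1 X) :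
    X.ncard ∈ ({1, 2} : Set ℕ) := by
  rcases hX with ⟨x, rfl⟩ | ⟨x, y, hxy, -, -, rfl⟩
  · simp
  · simp [Set.ncard_pair hxy]

theorem rel_mono {X Y : Set α} (hXY : X ⊆ Y) : rel X ≤ rel Y := fun _ _ h =>
  ⟨hXY h.1, hXY h.2.1, h.2.2⟩

theorem Pure.card_le {V : Type*} {X : Set (Finset V)} {n : ℕ} (hpure : Pure X n) {x : Finset V}
    (hx : x ∈ X) : x.card ≤ n + 1 := by
  obtain ⟨g, -, hg, hd⟩ := hpure x hx
  have := Finset.card_le_card hg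
  simp only [dim] at hd
  omega

section Complex

variable {V : Type*} [DecidableEq V]

/-- Nothing lies strictly between `h` and `insert v h`. -/
theorem thetaS_betaS_insert (X : Set (Finset V)) {h : Finset V} {v : V} (hv : v ∉ h) :
    thetaS (betaS X h) (insert v h) = betaS X (insert v h) := by
  ext y
  simp only [thetaS, alphaS, betaS, Set.mem_union, Set.mem_ofPred_eq]
  constructor
  · rintro (⟨⟨-, h1⟩, h2⟩ | ⟨⟨hy, -⟩, h2⟩)
    · have h1 := Finset.card_lt_card h1
      have h2 := Finset.card_lt_card h2
      rw [Finset.card_insert_of_notMem hv] at h2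
      omega
    · exact ⟨hy, h2⟩
  · rintro ⟨hy, h2⟩
    exact Or.inr ⟨⟨hy, (Finset.ssubset_insert hv).trans h2⟩, h2⟩

theorem IsSimplicialComplex.isManifoldAux_betaS {X : Set (Finset V)}
    (hsc : IsSimplicialComplex X) (h : Finset V) (hh : h ∈ X ∨ h = ∅) (k : ℕ)
    (hX : IsManifoldAux (k + 1 + h.card) X) : IsManifoldAux (k + 1) (betaS X h) := by
  induction h using Finset.induction_on generalizing k with
  | empty =>
    have : betaS X ∅ = X := by
      ext y
      simp only [betaS, Set.mem_ofPred_eq, and_iff_left_iff_imp]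
      exact fun hy => Finset.empty_ssubset.2 (hsc.2.1 y hy)
    simpa [this] using hX
  | insert v h hv ih =>
    have hins : insert v h ∈ X := hh.resolve_right (Finset.insert_ne_empty v h)
    have hmem : h ∈ X ∨ h = ∅ := by
      rcases h.eq_empty_or_nonempty with h0 | h0
      · exact Or.inr h0
      · exact Or.inl (hsc.2.2.1 _ hins h h0 (Finset.subset_insert v h))
    rw [Finset.card_insert_of_notMem hv] at hX
    have hM := ih hmem (k + 1) (by convert hX using 1; omega)
    rw [← thetaS_betaS_insert X hv]
    exact hM.thetaS ⟨hins, Finset.ssubset_insert hv⟩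

theorem IsSimplicialComplex.rank_eq {X : Set (Finset V)} (hsc : IsSimplicialComplex X)
    {x : Finset V} (hx : x ∈ X) : rank X x = x.card - 1 := by
  obtain ⟨k, hk⟩ : ∃ k, x.card = k + 1 :=
    ⟨x.card - 1, by have := (hsc.2.1 x hx).card_pos; omega⟩
  refine IsGreatest.csSup_eq ⟨?_, ?_⟩
  · rw [hk, Nat.add_sub_cancel]
    let e := (x.equivFinOfCardEq hk).symm.toEmbedding.trans (Function.Embedding.subtype _)
    have hsub : ∀ i, (Finset.Iic i).map e ⊆ x := by
      intro i y hy
      obtain ⟨j, -, rfl⟩ := Finset.mem_map.1 hy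
      exact ((x.equivFinOfCardEq hk).symm j).2
    refine ⟨fun i => (Finset.Iic i).map e, ?_, ?_, ?_⟩
    · intro i j hij
      exact Finset.map_ssubset_map.2 (Finset.Iic_ssubset_Iic.2 hij)
    · exact fun i => hsc.2.2.1 x hx _ (by simp) (hsub i)
    · refine Finset.eq_of_subset_of_card_le (hsub _) ?_
      simp [hk]
  · rintro m ⟨c, hc, hcX, hlast⟩
    have key : ∀ i : Fin (m + 1), (i : ℕ) + 1 ≤ (c i).card := by
      intro i
      induction i using Fin.induction with
      | zero => simpa using (hsc.2.1 _ (hcX 0)).card_pos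
      | succ i ih =>
        have := Finset.card_lt_card (hc i.castSucc_lt_succ)
        simp only [Fin.val_castSucc, Fin.val_succ] at ih ⊢
        omega
    have := key (Fin.last m)
    rw [hlast, Fin.val_last] at this
    omega

theorem IsSimplicialComplex.rankSet_eq {X : Set (Finset V)} (hsc : IsSimplicialComplex X)
    (hne : X.Nonempty) {n : ℕ} (hpure : Pure X n) : rankSet X = n := by
  rw [rankSet, if_neg hne.ne_empty, Nat.cast_inj]
  refine IsGreatest.csSup_eq ⟨?_, ?_⟩
  · obtain ⟨x, hx⟩ := hne
    obtain ⟨g, hg, -, hd⟩ := hpure x hx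
    refine ⟨g, hg, ?_⟩
    rw [hsc.rank_eq hg]
    simp only [dim] at hd
    omega
  · rintro _ ⟨x, hx, rfl⟩
    have := hpure.card_le hx
    rw [hsc.rank_eq hx]
    omega

/-- Any two facets containing `h` are joined by a path of facets and ridges containing `h`. -/
theorem IsSimplicialComplex.exists_path_above {X : Set (Finset V)}
    (hsc : IsSimplicialComplex X) {n : ℕ} (hn : 1 ≤ n) (hpure : Pure X n)
    (hX : IsManifoldAux (n + 1) X) (k : ℕ) (h : Finset V) (hh : h ∈ X ∨ h = ∅)
    (hk : h.card + k = n + 1) {a b : Finset V} (ha : a ∈ X) (hb : b ∈ X)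
    (hda : dim a = n) (hdb : dim b = n) (hha : h ⊆ a) (hhb : h ⊆ b) :
    Relation.ReflTransGen
      (rel {y | y ∈ X ∧ h ⊆ y ∧ (dim y = (n : ℤ) - 1 ∨ dim y = n)}) a b := by
  induction k using Nat.strong_induction_on generalizing h a b with
  | _ k ih =>
    have hca : a.card = n + 1 := by simp only [dim] at hda; omega
    have hcb : b.card = n + 1 := by simp only [dim] at hdb; omega
    match k with
    | 0 =>
      rw [← Finset.eq_of_subset_of_card_le hha (by omega),
        ← Finset.eq_of_subset_of_card_le hhb (by omega)]
    | 1 =>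
      have hdh : dim h = (n : ℤ) - 1 := by simp only [dim]; omega
      have hhX : h ∈ X := hh.resolve_right (by rintro rfl; simp at hk; omega)
      have hlt : ∀ g : Finset V, h ⊆ g → g.card = n + 1 → h < g := by
        intro g hg hc
        refine lt_of_le_of_ne hg ?_
        rintro rfl
        omega
      have h1 := hlt a hha hca
      have h2 := hlt b hhb hcb
      exact (Relation.ReflTransGen.single
        ⟨⟨ha, hha, Or.inr hda⟩, ⟨hhX, subset_rfl, Or.inl hdh⟩, h1.ne', Or.inr h1⟩).tail
        ⟨⟨hhX, subset_rfl, Or.inl hdh⟩, ⟨hb, hhb, Or.inr hdb⟩, h2.ne, Or.inl h2⟩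
    | k + 2 =>
      have hM : IsManifoldAux (k + 1 + 1) (betaS X h) :=
        hsc.isManifoldAux_betaS h hh (k + 1) (by convert hX using 1; omega)
      have hlt : ∀ g : Finset V, h ⊆ g → g.card = n + 1 → h < g := by
        intro g hg hc
        refine lt_of_le_of_ne hg ?_
        rintro rfl
        omega
      have hpath := hM.isConnected a ⟨ha, hlt a hha hca⟩ b ⟨hb, hlt b hhb hcb⟩
      have key : ∀ z, Relation.ReflTransGen (rel (betaS X h)) a z → ∀ g ∈ X, dim g = n →
          z ⊆ g → Relation.ReflTransGen
            (rel {y | y ∈ X ∧ h ⊆ y ∧ (dim y = (n : ℤ) - 1 ∨ dim y = n)}) a g := by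
        intro z hz
        induction hz with
        | refl =>
          intro g hg hdg hag
          rw [Finset.eq_of_subset_of_card_le hag (by simp only [dim] at hdg; omega)]
        | @tail z w _ hzw ihz =>
          intro g hg hdg hwg
          obtain ⟨hz, hw, -, hlt | hlt⟩ := hzw
          · exact ihz g hg hdg (hlt.le.trans hwg)
          · obtain ⟨g', hg', hzg', hdg'⟩ := hpure z hz.1
            refine (ihz g' hg' hdg' hzg').trans ?_
            have hcw := Finset.card_lt_card hw.2
            have hcw' := hpure.card_le hw.1
            refine Relation.ReflTransGen.mono
              (rel_mono ?_) _ _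
              (ih (n + 1 - w.card) (by omega) w (Or.inl hw.1) (by omega) hg' hg hdg' hdg
                (hlt.le.trans hzg') hwg)
            exact fun u hu => ⟨hu.1, hw.2.le.trans hu.2.1, hu.2.2⟩
      exact key b hpath b hb hdb subset_rfl

theorem IsSimplicialComplex.link {X : Set (Finset V)} (hsc : IsSimplicialComplex X)
    (h : Finset V) : IsSimplicialComplex (link h X) := by
  have hsub : ∀ a ∈ PCMPaper.link h X, ∀ b : Finset V, b.Nonempty → b ⊆ a →
      b ∈ PCMPaper.link h X := by
    rintro a ⟨ha, hd, hu⟩ b hb hba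
    refine ⟨hsc.2.2.1 a ha b hb hba, ?_, hsc.2.2.1 _ hu _ (hb.mono Finset.subset_union_right)
      (Finset.union_subset_union_right hba)⟩
    exact Finset.subset_empty.1 (hd ▸ Finset.inter_subset_inter_left hba)
  exact ⟨hsc.1.subset fun x hx => hx.1, fun x hx => hsc.2.1 x hx.1, hsub,
    fun a ha b _ hab => hsub a ha _ hab Finset.inter_subset_left⟩

theorem IsSimplicialComplex.sdiff_mem_link {X : Set (Finset V)} (hsc : IsSimplicialComplex X)
    {h g : Finset V} (hg : g ∈ X) (hhg : h ⊂ g) : g \ h ∈ PCMPaper.link h X := by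
  refine ⟨hsc.2.2.1 g hg _ (Finset.sdiff_nonempty.2 hhg.2) Finset.sdiff_subset,
    Finset.inter_sdiff_self h g, ?_⟩
  rwa [Finset.union_sdiff_of_subset hhg.1]

theorem dim_sdiff {h g : Finset V} (hhg : h ⊆ g) : dim (g \ h) = dim g - dim h - 1 := by
  have := Finset.card_sdiff_add_card_eq_card hhg
  simp only [dim]
  omega

theorem dim_union {h g : Finset V} (hhg : h ∩ g = ∅) : dim (h ∪ g) = dim h + dim g + 1 := by
  have := Finset.card_union_of_disjoint (Finset.disjoint_iff_inter_eq_empty.2 hhg)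
  simp only [dim]
  omega

theorem IsSimplicialComplex.isPseudomanifold_link {X : Set (Finset V)}
    (hsc : IsSimplicialComplex X) (hne : X.Nonempty) {n : ℕ} (hn : 1 ≤ n) (hpure : Pure X n)
    (hX : IsManifoldAux (n + 1) X) (h : Finset V) (hh : h ∈ X ∨ h = ∅) (hd : dim h ≤ n - 2) :
    IsPseudomanifold (PCMPaper.link h X) (n - dim h - 1) := by
  have hc : h.card + 1 ≤ n := by simp only [dim] at hd; omega
  have hm : ((n - h.card : ℕ) : ℤ) = n - dim h - 1 := by simp only [dim]; omega
  have hlt : ∀ g : Finset V, h ⊆ g → (n : ℤ) - 1 ≤ dim g → h ⊂ g := by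
    intro g hg hdg
    refine lt_of_le_of_ne hg ?_
    rintro rfl
    omega
  have hpl : Pure (PCMPaper.link h X) (n - dim h - 1) := by
    rintro x ⟨hx, hi, hu⟩
    obtain ⟨g, hg, hsub, hdg⟩ := hpure _ hu
    have hhg : h ⊆ g := Finset.subset_union_left.trans hsub
    refine ⟨g \ h, hsc.sdiff_mem_link hg (hlt g hhg (by omega)), ?_, by rw [dim_sdiff hhg, hdg]⟩
    exact Finset.subset_sdiff.2 ⟨Finset.subset_union_right.trans hsub,
      (Finset.disjoint_iff_inter_eq_empty.2 hi).symm⟩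
  have hnel : (PCMPaper.link h X).Nonempty := by
    obtain ⟨g, hg, hhg, hdg⟩ : ∃ g ∈ X, h ⊆ g ∧ dim g = n := by
      rcases hh with hh | rfl
      · exact hpure h hh
      · obtain ⟨x, hx⟩ := hne
        obtain ⟨g, hg, -, hdg⟩ := hpure x hx
        exact ⟨g, hg, Finset.empty_subset g, hdg⟩
    exact ⟨_, hsc.sdiff_mem_link hg (hlt g hhg (by omega))⟩
  refine ⟨hsc.link h, ?_, Or.inr ⟨by omega, hpl, ?_, ?_⟩⟩
  · rw [← hm] at hpl ⊢
    exact (hsc.link h).rankSet_eq hnel hpl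
  · rintro x ⟨hx, hi, hu⟩ hdx
    have hdu := dim_union hi
    have hcu : (h ∪ x).card = n := by simp only [dim] at hdu hdx; omega
    have hM : IsManifoldAux (0 + 1) (betaS X (h ∪ x)) :=
      hsc.isManifoldAux_betaS _ (Or.inl hu) 0 (by convert hX using 1; omega)
    convert hM.ncard_of_one using 1
    refine Set.ncard_congr (fun g _ => h ∪ g) ?_ ?_ ?_
    · rintro g ⟨⟨hg, hgi, hgu⟩, hxg, hdg⟩
      refine ⟨hgu, lt_of_le_of_ne (Finset.union_subset_union_right hxg) ?_⟩
      intro he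
      have := dim_union hgi
      rw [← he] at this
      omega
    · rintro g g' ⟨⟨-, hgi, -⟩, -⟩ ⟨⟨-, hgi', -⟩, -⟩ he
      have h1 := Finset.union_sdiff_cancel_left (Finset.disjoint_iff_inter_eq_empty.2 hgi)
      have h2 := Finset.union_sdiff_cancel_left (Finset.disjoint_iff_inter_eq_empty.2 hgi')
      rw [← h1, ← h2]
      exact congrArg (· \ h) he
    · rintro y ⟨hy, hlty⟩
      have hhy : h ⊆ y := Finset.subset_union_left.trans hlty.le
      have hcy := Finset.card_lt_card hlty
      have hcy' := hpure.card_le hy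
      have hdy : dim y = n := by simp only [dim]; omega
      refine ⟨y \ h, ⟨hsc.sdiff_mem_link hy (hlt y hhy (by omega)), ?_, ?_⟩,
        Finset.union_sdiff_of_subset hhy⟩
      · exact Finset.subset_sdiff.2 ⟨Finset.subset_union_right.trans hlty.le,
          (Finset.disjoint_iff_inter_eq_empty.2 hi).symm⟩
      · rw [dim_sdiff hhy, hdy]
  · rintro a ⟨-, hai, hau⟩ hda b ⟨-, hbi, hbu⟩ hdb
    have hpath := hsc.exists_path_above hn hpure hX (n + 1 - h.card) h hh (by omega) hau hbu
      (by rw [dim_union hai]; omega) (by rw [dim_union hbi]; omega)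
      Finset.subset_union_left Finset.subset_union_left
    have hlift := hpath.lift (p := rel {g | g ∈ PCMPaper.link h X ∧
      (dim g = n - dim h - 1 - 1 ∨ dim g = n - dim h - 1)}) (fun g => g \ h) ?_
    · simpa [Function.onFun,
        Finset.union_sdiff_cancel_left (Finset.disjoint_iff_inter_eq_empty.2 hai),
        Finset.union_sdiff_cancel_left (Finset.disjoint_iff_inter_eq_empty.2 hbi)] using hlift
    · have hmem : ∀ g, g ∈ X ∧ h ⊆ g ∧ (dim g = (n : ℤ) - 1 ∨ dim g = n) →
          g \ h ∈ {g | g ∈ PCMPaper.link h X ∧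
            (dim g = n - dim h - 1 - 1 ∨ dim g = n - dim h - 1)} := by
        rintro g ⟨hg, hhg, hdg⟩
        refine ⟨hsc.sdiff_mem_link hg (hlt g hhg (by omega)), ?_⟩
        rw [dim_sdiff hhg]
        omega
      have hmono : ∀ g g' : Finset V, h ⊆ g → g < g' → g \ h < g' \ h := by
        intro g g' hg hgg'
        have hle : g \ h ⊆ g' \ h := Finset.sdiff_subset_sdiff hgg'.le subset_rfl
        refine lt_of_le_of_ne hle fun he => hgg'.ne ?_
        rw [← Finset.union_sdiff_of_subset hg, he,
          Finset.union_sdiff_of_subset (hg.trans hgg'.le)]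
      rintro g g' ⟨hg, hg', -, hgg' | hgg'⟩
      · have := hmono g g' hg.2.1 hgg'
        exact ⟨hmem g hg, hmem g' hg', this.ne, Or.inl this⟩
      · have := hmono g' g hg'.2.1 hgg'
        exact ⟨hmem g hg, hmem g' hg', this.ne', Or.inr this⟩

end Complex

/-- Let `X` be a pure simplicial complex of rank `n ≥ 2`.  If `X` is an
`n`-PCM or an `n`-surface, then `X` is a normal pseudomanifold of rank `n`. -/
theorem statement_16 {V : Type*} [DecidableEq V] (X : Set (Finset V)) (n : ℤ) (hn : 2 ≤ n)
    (hsc : IsSimplicialComplex X) (hrk : rankSet X = n) (hpure : Pure X n)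
    (hX : IsPCM n X ∨ IsSurface n X) :
    IsNormalPseudomanifold X n := by
  lift n to ℕ using by omega
  have hM : IsManifoldAux (n + 1) X := by
    rcases hX with ⟨k, hk, hX⟩ | ⟨k, hk, hX⟩
    · obtain rfl : k = n + 1 := by omega
      exact Or.inl hX
    · obtain rfl : k = n + 1 := by omega
      exact Or.inr hX
  have hne : X.Nonempty := by
    rw [Set.nonempty_iff_ne_empty]
    rintro rfl
    simp [rankSet] at hrk
  have hl := hsc.isPseudomanifold_link hne (by omega) hpure hM
  refine ⟨?_, fun h hh hd => hl h (Or.inl hh) hd⟩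
  have h0 := hl ∅ (Or.inr rfl) (by simp only [dim, Finset.card_empty]; omega)
  have hlink : link ∅ X = X := by ext; simp [link]
  simpa [hlink, dim] using h0

end PCMPaper
end

section
/- Let X be an n-PCM. Then: (1) if n ∈ {−1, 0}, X is a smooth n-PCM; (2) if X is a simplicial complex of rank n = 1, then X is a smooth 1-PCM; (3) if X is a simplicial complex of rank n ≥ 2 and for every h ∈ ΔX the poset θ□_{ΔX}(h) is a discrete (n−2)-surface, then X is a smooth n-PCM. -/
namespace PCMPaper

variable {α : Type*} [PartialOrder α]

theorem mem_thetaS {X : Set α} {h x : α} : x ∈ thetaS X h ↔ x ∈ X ∧ (x < h ∨ h < x) := by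
  simp only [thetaS, alphaS, betaS, Set.mem_union, Set.mem_ofPred_eq]
  tauto

theorem thetaS_subset (X : Set α) (h : α) : thetaS X h ⊆ X := fun _ hx => (mem_thetaS.1 hx).1

theorem thetaS_mono {X Y : Set α} (hXY : X ⊆ Y) (h : α) : thetaS X h ⊆ thetaS Y h := fun _ hx =>
  mem_thetaS.2 ⟨hXY (mem_thetaS.1 hx).1, (mem_thetaS.1 hx).2⟩

theorem thetaS_thetaS_comm (X : Set α) (h x : α) :
    thetaS (thetaS X h) x = thetaS (thetaS X x) h := by
  ext y
  simp only [mem_thetaS]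
  tauto

theorem border_subset (X : Set α) : border X ⊆ X := fun _ hx => hx.1

theorem isSurface_iff {k : ℤ} {n : ℕ} (hn : (n : ℤ) = k + 1) {X : Set α} :
    IsSurface k X ↔ IsSurfaceAux n X := by
  constructor
  · rintro ⟨m, hm, hX⟩
    obtain rfl : m = n := by omega
    exact hX
  · exact fun hX => ⟨n, hn, hX⟩

theorem isPCM_iff {k : ℤ} {n : ℕ} (hn : (n : ℤ) = k + 1) {X : Set α} :
    IsPCM k X ↔ IsPCMAux n X := by
  constructor
  · rintro ⟨m, hm, hX⟩
    obtain rfl : m = n := by omega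
    exact hX
  · exact fun hX => ⟨n, hn, hX⟩

/-- The border of the neighbourhood of a border element lies in the border. -/
theorem border_thetaS_subset {m : ℕ} {X : Set α} (hX : IsPCMAux (m + 3) X) {h : α}
    (hh : h ∈ border X) : border (thetaS X h) ⊆ border X := by
  intro x hx
  have hxX := mem_thetaS.1 hx.1
  by_contra hxb
  have hpcm : IsPCMAux (m + 2) (thetaS X h) := (hX.2.2.2 h hh.1).1 hh
  have hsurf : IsSurfaceAux (m + 2) (thetaS X x) := (hX.2.2.2 x hxX.1).2 hxb
  refine hx.2 ((isSurface_iff (n := m + 1) ?_).2 ?_)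
  · rw [hpcm.1]
    push_cast
    ring
  · rw [thetaS_thetaS_comm]
    exact hsurf.2.2 h (mem_thetaS.2 ⟨hh.1, hxX.2.symm⟩)

theorem isSeparatedUnion_of_isSurfaceAux {m : ℕ} {X : Set α} (hX : IsSurfaceAux m X) :
    IsSeparatedUnionOfSurfacesAux m X := by
  refine ⟨{X}, Set.singleton_nonempty X, by simp, by simpa using hX, ?_⟩
  rintro S rfl T rfl hne
  exact absurd rfl hne

/-- A 1-PCM has an even number of border elements: these are the vertices of degree one of its
comparability graph, all other vertices having degree two. -/
theorem even_ncard_border {X : Set α} (hfin : X.Finite) (hX : IsPCMAux 2 X) :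
    Even (border X).ncard := by
  classical
  have : Fintype X := hfin.fintype
  let G : SimpleGraph X :=
    { Adj := fun x y => x.1 < y.1 ∨ y.1 < x.1
      symm := ⟨fun _ _ h => h.symm⟩
      loopless := ⟨fun x h => by simp at h⟩ }
  have hdeg (x : X) : G.degree x = (thetaS X x.1).ncard := by
    rw [← SimpleGraph.card_neighborFinset_eq_degree, ← Set.ncard_coe_finset,
      ← Set.ncard_image_of_injective _ Subtype.val_injective]
    congr 1
    ext y
    simp only [SimpleGraph.coe_neighborFinset, Set.mem_image, SimpleGraph.mem_neighborSet,
      Subtype.exists, exists_and_right, exists_eq_right, mem_thetaS]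
    constructor
    · rintro ⟨hy, h⟩
      exact ⟨hy, h.symm⟩
    · rintro ⟨hy, h⟩
      exact ⟨hy, h.symm⟩
  have hodd (x : X) : Odd (G.degree x) ↔ x.1 ∈ border X := by
    rw [hdeg]
    by_cases hx : x.1 ∈ border X
    · obtain ⟨y, hy⟩ : IsPCMAux 1 (thetaS X x.1) := (hX.2.2.2 x.1 x.2).1 hx
      simp [hy, hx]
    · obtain ⟨y, z, hne, -, -, hyz⟩ : IsSurfaceAux 1 (thetaS X x.1) := (hX.2.2.2 x.1 x.2).2 hx
      rw [hyz, Set.ncard_pair hne]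
      simp [hx]
  have key := G.even_card_odd_degree_vertices
  rw [← Set.ncard_coe_finset, ← Set.ncard_image_of_injective _ Subtype.val_injective] at key
  convert key using 2
  ext y
  simp only [hodd, Finset.coe_filter, Finset.mem_univ, true_and, Set.mem_image, Set.mem_ofPred_eq,
    Subtype.exists, exists_and_left, exists_prop, exists_eq_right_right]
  exact ⟨fun h => ⟨h, h.1⟩, fun h => h.1⟩

theorem eq_of_subset_of_thetaS_subset {Y B : Set α} (hY : IsConnected Y) (hBY : B ⊆ Y)
    (hB : B.Nonempty) (hcl : ∀ h ∈ B, thetaS Y h ⊆ B) : B = Y := by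
  obtain ⟨b, hb⟩ := hB
  refine hBY.antisymm fun y hy => ?_
  have := hY b (hBY hb) y hy
  clear hy
  induction this with
  | refl => exact hb
  | tail _ hr ih => exact hcl _ ih (mem_thetaS.2 ⟨hr.2.1, hr.2.2.2.symm⟩)

/-- A PCM whose border is contained in a surface of codimension one has this surface as its border
and is smooth. -/
theorem border_eq_and_isSmoothPCMAux (m : ℕ) : ∀ X Y : Set α, X.Finite → IsPCMAux (m + 2) X →
    IsSurfaceAux (m + 1) Y → border X ⊆ Y → Y ⊆ X → border X = Y ∧ IsSmoothPCMAux (m + 2) X := by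
  induction m with
  | zero =>
    intro X Y hfin hX hY hsub hYX
    have heq : border X = Y := by
      obtain ⟨x, y, hne, -, -, rfl⟩ := hY
      refine Set.eq_of_subset_of_ncard_le hsub ?_ (hfin.subset hYX)
      rw [Set.ncard_pair hne]
      have h0 : (border X).ncard ≠ 0 := by
        rw [Ne, Set.ncard_eq_zero (hfin.subset (border_subset X))]
        exact hX.2.2.1
      obtain ⟨k, hk⟩ := even_ncard_border hfin hX
      omega
    refine ⟨heq, hX.1, hX.2.1, hX.2.2.1, ?_, fun h hh => ?_⟩
    · rw [heq]
      exact isSeparatedUnion_of_isSurfaceAux hY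
    · by_cases hb : h ∈ border X
      · exact Or.inr ((hX.2.2.2 h hh).1 hb)
      · exact Or.inl ((hX.2.2.2 h hh).2 hb)
  | succ m ih =>
    intro X Y hfin hX hY hsub hYX
    have key (h : α) (hh : h ∈ border X) : border (thetaS X h) = thetaS Y h ∧
        IsSmoothPCMAux (m + 2) (thetaS X h) := by
      refine ih _ _ (hfin.subset (thetaS_subset X h)) ((hX.2.2.2 h hh.1).1 hh)
        (hY.2.2 h (hsub hh)) (fun x hx => ?_) (thetaS_mono hYX h)
      exact mem_thetaS.2 ⟨hsub (border_thetaS_subset hX hh hx), (mem_thetaS.1 hx.1).2⟩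
    have heq : border X = Y := by
      refine eq_of_subset_of_thetaS_subset hY.2.1 hsub
        (Set.nonempty_iff_ne_empty.2 hX.2.2.1) fun h hh => ?_
      rw [← (key h hh).1]
      exact border_thetaS_subset hX hh
    refine ⟨heq, hX.1, hX.2.1, hX.2.2.1, ?_, fun h hh => ?_⟩
    · rw [heq]
      exact isSeparatedUnion_of_isSurfaceAux hY
    · by_cases hb : h ∈ border X
      · exact Or.inr (key h hb).2
      · exact Or.inl ((hX.2.2.2 h hh).2 hb)

/-- A nonempty poset whose neighbourhoods are all `m`-surfaces is the separated union of its
connected components, which are `(m+1)`-surfaces. -/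
theorem isSeparatedUnion_of_forall_thetaS {m : ℕ} {Y : Set α} (hne : Y.Nonempty)
    (hY : ∀ h ∈ Y, IsSurfaceAux (m + 1) (thetaS Y h)) :
    IsSeparatedUnionOfSurfacesAux (m + 2) Y := by
  let C : α → Set α := fun x => {y | Relation.ReflTransGen (rel Y) x y}
  have hsymm : ∀ x y, rel Y x y → rel Y y x := fun x y h =>
    ⟨h.2.1, h.1, h.2.2.1.symm, h.2.2.2.symm⟩
  have hrev {x y : α} (h : Relation.ReflTransGen (rel Y) x y) :
      Relation.ReflTransGen (rel Y) y x := by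
    induction h with
    | refl => exact .refl
    | tail _ hr ih => exact .head (hsymm _ _ hr) ih
  have hmem {x y : α} (hx : x ∈ Y) (h : y ∈ C x) : y ∈ Y := by
    induction (h : Relation.ReflTransGen (rel Y) x y) with
    | refl => exact hx
    | tail _ hr _ => exact hr.2.1
  have hCeq {x y : α} (h : y ∈ C x) : C y = C x := by
    ext z
    exact ⟨fun hz => Relation.ReflTransGen.trans h hz,
      fun hz => Relation.ReflTransGen.trans (hrev h) hz⟩
  have hlift {x y : α} (hx : x ∈ Y) (h : y ∈ C x) : Relation.ReflTransGen (rel (C x)) x y := by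
    induction (h : Relation.ReflTransGen (rel Y) x y) with
    | refl => exact .refl
    | tail hab hr ih => exact ih.tail ⟨hab, hab.tail hr, hr.2.2⟩
  have hstep {x y : α} (hx : x ∈ Y) (hy : y ∈ Y) (hxy : x < y ∨ y < x) : y ∈ C x :=
    .single ⟨hx, hy, by rintro rfl; simp at hxy, hxy⟩
  refine ⟨C '' Y, hne.image C, ?_, ?_, ?_⟩
  · ext y
    simp only [Set.sUnion_image, Set.mem_iUnion, exists_prop]
    exact ⟨fun hy => ⟨y, hy, .refl⟩, fun ⟨x, hx, hxy⟩ => hmem hx hxy⟩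
  · rintro _ ⟨x, hx, rfl⟩
    refine ⟨⟨x, .refl⟩, fun y hy z hz => ?_, fun h hh => ?_⟩
    · rw [← hCeq hy]
      rw [← hCeq hy] at hz
      exact hlift (hmem hx hy) hz
    · have heq : thetaS (C x) h = thetaS Y h := by
        ext z
        simp only [mem_thetaS]
        constructor
        · exact fun ⟨hz, hzh⟩ => ⟨hmem hx hz, hzh⟩
        · refine fun ⟨hz, hzh⟩ => ⟨?_, hzh⟩
          rw [← hCeq hh]
          exact hstep (hmem hx hh) hz hzh.symm
      rw [heq]
      exact hY h (hmem hx hh)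
  · rintro _ ⟨s, hs, rfl⟩ _ ⟨t, ht, rfl⟩ hst x hx y hy
    have hdisj : y ∉ C x := fun h => hst (by rw [← hCeq hx, ← hCeq hy, hCeq h])
    refine ⟨fun hle => hdisj ?_, fun hle => hdisj ?_⟩
    · obtain rfl | hlt := hle.eq_or_lt
      · exact .refl
      · exact hstep (hmem hs hx) (hmem ht hy) (.inl hlt)
    · obtain rfl | hlt := hle.eq_or_lt
      · exact .refl
      · exact hstep (hmem hs hx) (hmem ht hy) (.inr hlt)

theorem exists_pairing {S : Set α} (hanti : IsAntichain (· ≤ ·) S) (k : ℕ)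
    (hk : S.ncard = k + k) (hfin : S.Finite) :
    ∃ P : Set (Set α), S = ⋃₀ P ∧ (∀ T ∈ P, IsSurfaceAux 1 T) ∧ P.PairwiseDisjoint id := by
  induction k generalizing S with
  | zero =>
    obtain rfl : S = ∅ := by rwa [add_zero, Set.ncard_eq_zero hfin] at hk
    exact ⟨∅, by simp⟩
  | succ k ih =>
    obtain ⟨x, hx⟩ : S.Nonempty := (Set.ncard_pos hfin).1 (by omega)
    have h1 : (S \ {x}).ncard = k + k + 1 := by
      rw [Set.ncard_sdiff_singleton_of_mem hx]
      omega
    obtain ⟨y, hy⟩ : (S \ {x}).Nonempty := (Set.ncard_pos hfin.sdiff).1 (by omega)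
    have h2 : ((S \ {x}) \ {y}).ncard = k + k := by
      rw [Set.ncard_sdiff_singleton_of_mem hy]
      omega
    have hsub : (S \ {x}) \ {y} ⊆ S := fun _ h => h.1.1
    obtain ⟨P, hP, hsurf, hdisj⟩ := ih (hanti.subset hsub) h2 (hfin.subset hsub)
    have hxy : x ≠ y := fun h => hy.2 h.symm
    refine ⟨insert {x, y} P, ?_, ?_, ?_⟩
    · rw [Set.sUnion_insert, ← hP]
      ext z
      have hyS := hy.1
      clear hP
      by_cases hzx : z = x <;> by_cases hzy : z = y <;> simp_all
    · rintro T (rfl | hT)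
      · exact ⟨x, y, hxy, fun h => hanti hx hy.1 hxy h.le,
          fun h => hanti hy.1 hx hxy.symm h.le, rfl⟩
      · exact hsurf T hT
    · refine hdisj.insert fun T hT _ => ?_
      have hTS : T ⊆ (S \ {x}) \ {y} := hP ▸ Set.subset_sUnion_of_mem hT
      rw [id, id, Set.disjoint_left]
      rintro z (rfl | rfl) hz
      · exact (hTS hz).1.2 rfl
      · exact (hTS hz).2 rfl

theorem isSeparatedUnion_of_even_ncard {S : Set α} (hanti : IsAntichain (· ≤ ·) S)
    (hev : Even S.ncard) (hfin : S.Finite) (hne : S.Nonempty) :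
    IsSeparatedUnionOfSurfacesAux 1 S := by
  obtain ⟨k, hk⟩ := hev
  obtain ⟨P, hP, hsurf, hdisj⟩ := exists_pairing hanti k hk hfin
  refine ⟨P, ?_, hP, hsurf, fun A hA B hB hAB x hx y hy => ?_⟩
  · by_contra h
    rw [Set.not_nonempty_iff_eq_empty] at h
    simp [hP, h] at hne
  · have hxy : x ≠ y := by
      rintro rfl
      exact Set.disjoint_left.1 (hdisj hA hB hAB) hx hy
    have hxS : x ∈ S := hP ▸ Set.mem_sUnion_of_mem hx hA
    have hyS : y ∈ S := hP ▸ Set.mem_sUnion_of_mem hy hB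
    exact ⟨hanti hxS hyS hxy, hanti hyS hxS hxy.symm⟩

theorem isAntichain_border {V : Type*} [DecidableEq V] {X : Set (Finset V)}
    (hX : IsSimplicialComplex X) (hpcm : IsPCMAux 2 X) : IsAntichain (· ≤ ·) (border X) := by
  have hcard (h : Finset V) (hh : h ∈ border X) : h.card = 1 := by
    have hpos := Finset.card_pos.2 (hX.2.1 h hh.1)
    by_contra hne
    obtain ⟨v, hv, w, hw, hvw⟩ := Finset.one_lt_card.1 (show 1 < h.card by omega)
    obtain ⟨s, hs⟩ : IsPCMAux 1 (thetaS X h) := (hpcm.2.2.2 h hh.1).1 hh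
    have hvert (u : V) (hu : u ∈ h) : {u} = s := by
      have hmem : ({u} : Finset V) ∈ thetaS X h := by
        have hle : ({u} : Finset V) ⊆ h := by simpa using hu
        refine mem_thetaS.2 ⟨hX.2.2.1 h hh.1 _ (Finset.singleton_nonempty u) hle, .inl ?_⟩
        refine lt_of_le_of_ne hle ?_
        rintro rfl
        simp at hne
      rwa [hs] at hmem
    exact hvw (Finset.singleton_injective ((hvert v hv).trans (hvert w hw).symm))
  intro a ha b hb hne hle
  exact hne (Finset.eq_of_subset_of_card_le hle (by rw [hcard a ha, hcard b hb]))

/-- (1) every `n`-PCM with `n ∈ {-1, 0}` is a smooth `n`-PCM;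
(2) every `1`-PCM which is a simplicial complex of rank `1` is a smooth `1`-PCM;
(3) every `n`-PCM which is a simplicial complex of rank `n ≥ 2` such that for every
`h ∈ ΔX` the poset `θ□_{ΔX}(h)` is a discrete `(n-2)`-surface, is a smooth `n`-PCM. -/
theorem statement_19 {α : Type*} [PartialOrder α] {V : Type*} [DecidableEq V] :
    (∀ X : Set α, X.Finite → ∀ n : ℤ, (n = -1 ∨ n = 0) → IsPCM n X → IsSmoothPCM n X) ∧
    (∀ X : Set (Finset V), IsSimplicialComplex X → rankSet X = 1 →
      IsPCM 1 X → IsSmoothPCM 1 X) ∧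
    (∀ X : Set (Finset V), ∀ n : ℤ, 2 ≤ n → IsSimplicialComplex X → rankSet X = n →
      IsPCM n X →
      (∀ h ∈ border X, IsSurface (n - 2) (thetaS (border X) h)) →
      IsSmoothPCM n X) := by
  refine ⟨?_, ?_, ?_⟩
  · rintro X - n (rfl | rfl) ⟨m, hm, hX⟩
    · obtain rfl : m = 0 := by omega
      exact ⟨0, hm, hX⟩
    · obtain rfl : m = 1 := by omega
      exact ⟨1, hm, hX⟩
  · intro X hsc _ hpcm
    have hX : IsPCMAux 2 X := (isPCM_iff (by norm_num)).1 hpcm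
    refine ⟨2, by norm_num, hX.1, hX.2.1, hX.2.2.1, ?_, fun h hh => ?_⟩
    · exact isSeparatedUnion_of_even_ncard (isAntichain_border hsc hX)
        (even_ncard_border hsc.1 hX) (hsc.1.subset (border_subset X))
        (Set.nonempty_iff_ne_empty.2 hX.2.2.1)
    · by_cases hb : h ∈ border X
      · exact Or.inr ((hX.2.2.2 h hh).1 hb)
      · exact Or.inl ((hX.2.2.2 h hh).2 hb)
  · intro X n hn hsc _ hpcm hsurf
    obtain ⟨m, rfl⟩ : ∃ m : ℕ, n = m + 2 := ⟨(n - 2).toNat, by omega⟩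
    have hX : IsPCMAux (m + 3) X := (isPCM_iff (by push_cast; ring)).1 hpcm
    have hY (h : Finset V) (hh : h ∈ border X) : IsSurfaceAux (m + 1) (thetaS (border X) h) :=
      (isSurface_iff (by push_cast; ring)).1 (hsurf h hh)
    refine ⟨m + 3, by push_cast; ring, hX.1, hX.2.1, hX.2.2.1, ?_, fun h hh => ?_⟩
    · exact isSeparatedUnion_of_forall_thetaS (Set.nonempty_iff_ne_empty.2 hX.2.2.1) hY
    · by_cases hb : h ∈ border X
      · refine Or.inr (border_eq_and_isSmoothPCMAux m _ _ (hsc.1.subset (thetaS_subset X h))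
          ((hX.2.2.2 h hh).1 hb) (hY h hb) (fun x hx => ?_)
          (thetaS_mono (border_subset X) h)).2
        exact mem_thetaS.2 ⟨border_thetaS_subset hX hb hx, (mem_thetaS.1 hx.1).2⟩
      · exact Or.inl ((hX.2.2.2 h hh).2 hb)

end PCMPaper
end
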